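/- Let K be a field, d ≥ 2, and U, V finite-dimensional K-vector spaces. For q ∈ Λ^d(U ⊕ V), write q = q_0 + q_1 + ⋯ + q_d according to the decomposition Λ^d(U ⊕ V) = ⊕_{i=0}^d Λ^{d−i}U ⊗ Λ^iV, so that q_d ∈ Λ^d V. Then S(q) ≤ dim U + S(q_d). -/

import Mathlib

noncomputable section

/-- `q ∈ Λ^d M` admits a strength decomposition with exactly `k` terms:
`q = r 0 ∧ s 0 + ⋯ + r (k-1) ∧ s (k-1)` with `r i ∈ Λ^{e i} M`, `s i ∈ Λ^{d - e i} M`, and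
`e i ∈ {1, …, d-1}`.  (The wedge product is the product of the exterior algebra.) -/
def ExtDecomp (K : Type) [Field K] (d : ℕ) {M : Type} [AddCommGroup M] [Module K M]
    (q : ExteriorAlgebra K M) (k : ℕ) : Prop :=
  ∃ (e : Fin k → ℕ) (r s : Fin k → ExteriorAlgebra K M),
    (∀ i, 1 ≤ e i) ∧ (∀ i, e i ≤ d - 1) ∧
    (∀ i, r i ∈ ⋀[K]^(e i) M) ∧ (∀ i, s i ∈ ⋀[K]^(d - e i) M) ∧
    q = ∑ i, r i * s i

/-- The strength `S(q)` of an alternating tensor `q ∈ Λ^d M`: the minimal number of terms in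
a strength decomposition of `q` (with the convention `S(0) = 0`). -/
def extStrength (K : Type) [Field K] (d : ℕ) {M : Type} [AddCommGroup M] [Module K M]
    (q : ExteriorAlgebra K M) : ℕ :=
  sInf {k | ExtDecomp K d q k}

section

variable {K : Type} [Field K] {M N : Type} [AddCommGroup M] [Module K M]
  [AddCommGroup N] [Module K N]

theorem ExteriorAlgebra.map_mem_exteriorPower (f : M →ₗ[K] N) {d : ℕ} {x : ExteriorAlgebra K M}
    (hx : x ∈ ⋀[K]^d M) : ExteriorAlgebra.map f x ∈ ⋀[K]^d N := by
  have h : (⋀[K]^d M).map (ExteriorAlgebra.map f).toLinearMap ≤ ⋀[K]^d N := by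
    rw [Submodule.map_pow]
    refine pow_le_pow_left' ?_ d
    rintro _ ⟨_, ⟨m, rfl⟩, rfl⟩
    exact ⟨f m, by simp⟩
  exact h ⟨x, hx, rfl⟩

theorem ExteriorAlgebra.ι_mul_mem_exteriorPower (m : M) {d : ℕ} {x : ExteriorAlgebra K M}
    (hx : x ∈ ⋀[K]^d M) : ExteriorAlgebra.ι K m * x ∈ ⋀[K]^(d + 1) M := by
  rw [ExteriorAlgebra.exteriorPower, pow_succ']
  exact Submodule.mul_mem_mul ⟨m, rfl⟩ hx

theorem ExteriorAlgebra.map_zero_eq_zero {d : ℕ} {q : ExteriorAlgebra K M}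
    (hq : q ∈ ⋀[K]^(d + 1) M) : ExteriorAlgebra.map (0 : M →ₗ[K] N) q = 0 := by
  rw [ExteriorAlgebra.exteriorPower, pow_succ'] at hq
  induction hq using Submodule.mul_induction_on' with
  | mem_mul_mem a ha x hx =>
    obtain ⟨m, rfl⟩ := ha
    simp
  | add x _ y _ hx hy => rw [map_add, hx, hy, add_zero]

/-- If `id - p` takes values in the span of `b`, then `q - Λ^{d+1} p (q)` is a sum of products
`b i ∧ s i` with `s i ∈ Λ^d M`. -/
theorem ExteriorAlgebra.exists_sub_map_eq_sum {u : ℕ} (p : M →ₗ[K] M) (b : Fin u → M)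
    (hb : ∀ m, ∃ c : Fin u → K, m = ∑ i, c i • b i + p m) (d : ℕ) {q : ExteriorAlgebra K M}
    (hq : q ∈ ⋀[K]^(d + 1) M) :
    ∃ s : Fin u → ExteriorAlgebra K M, (∀ i, s i ∈ ⋀[K]^d M) ∧
      q - ExteriorAlgebra.map p q = ∑ i, ExteriorAlgebra.ι K (b i) * s i := by
  induction d generalizing q with
  | zero =>
    rw [zero_add, ExteriorAlgebra.exteriorPower, pow_one] at hq
    obtain ⟨m, rfl⟩ := hq
    obtain ⟨c, hc⟩ := hb m
    refine ⟨fun i => algebraMap K _ (c i), fun i => ?_, ?_⟩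
    · rw [ExteriorAlgebra.exteriorPower, pow_zero]
      exact Submodule.algebraMap_mem _
    · rw [ExteriorAlgebra.map_apply_ι, ← map_sub]
      rw [sub_eq_of_eq_add hc, map_sum]
      refine Finset.sum_congr rfl fun i _ => ?_
      rw [map_smul, Algebra.smul_def, Algebra.commutes]
  | succ d ih =>
    rw [ExteriorAlgebra.exteriorPower, pow_succ'] at hq
    induction hq using Submodule.mul_induction_on' with
    | mem_mul_mem a ha x hx =>
      obtain ⟨m, rfl⟩ := ha
      obtain ⟨c, hc⟩ := hb m
      obtain ⟨s, hs, hsx⟩ := ih hx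
      refine ⟨fun i => c i • x - ExteriorAlgebra.ι K (p m) * s i, fun i =>
        Submodule.sub_mem _ (Submodule.smul_mem _ _ hx) (ι_mul_mem_exteriorPower _ (hs i)), ?_⟩
      have hm : ExteriorAlgebra.ι K m
          = ∑ i, c i • ExteriorAlgebra.ι K (b i) + ExteriorAlgebra.ι K (p m) := by
        conv_lhs => rw [hc]
        simp only [map_add, map_sum, map_smul]
      have hx' : ExteriorAlgebra.map p x = x - ∑ i, ExteriorAlgebra.ι K (b i) * s i := by
        rw [← hsx, sub_sub_cancel]
      have hswap (i : Fin u) : ExteriorAlgebra.ι K (p m) * (ExteriorAlgebra.ι K (b i) * s i)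
          = -(ExteriorAlgebra.ι K (b i) * (ExteriorAlgebra.ι K (p m) * s i)) := by
        rw [← mul_assoc, ← mul_assoc, ← neg_mul,
          eq_neg_of_add_eq_zero_left (ExteriorAlgebra.ι_add_mul_swap (p m) (b i))]
      rw [map_mul, ExteriorAlgebra.map_apply_ι, hx', hm]
      simp only [mul_sub, add_mul, Finset.sum_mul, Finset.mul_sum, hswap, mul_smul_comm,
        smul_mul_assoc, Finset.sum_sub_distrib, Finset.sum_neg_distrib]
      abel
    | add x _ y _ hx hy =>
      obtain ⟨s, hs, hsx⟩ := hx
      obtain ⟨t, ht, hty⟩ := hy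
      refine ⟨s + t, fun i => Submodule.add_mem _ (hs i) (ht i), ?_⟩
      simp only [map_add, add_sub_add_comm, hsx, hty, Pi.add_apply, mul_add,
        Finset.sum_add_distrib]

theorem ExtDecomp.add {d k l : ℕ} {x y : ExteriorAlgebra K M} (hx : ExtDecomp K d x k)
    (hy : ExtDecomp K d y l) : ExtDecomp K d (x + y) (k + l) := by
  obtain ⟨e, r, s, h₁, h₂, h₃, h₄, rfl⟩ := hx
  obtain ⟨e', r', s', h₁', h₂', h₃', h₄', rfl⟩ := hy
  refine ⟨Fin.append e e', Fin.append r r', Fin.append s s', ?_, ?_, ?_, ?_, ?_⟩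
  · exact Fin.addCases (by simpa using h₁) (by simpa using h₁')
  · exact Fin.addCases (by simpa using h₂) (by simpa using h₂')
  · exact Fin.addCases (by simpa using h₃) (by simpa using h₃')
  · exact Fin.addCases (by simpa using h₄) (by simpa using h₄')
  · simp [Fin.sum_univ_add]

theorem ExtDecomp.map (f : M →ₗ[K] N) {d k : ℕ} {x : ExteriorAlgebra K M}
    (hx : ExtDecomp K d x k) : ExtDecomp K d (ExteriorAlgebra.map f x) k := by
  obtain ⟨e, r, s, h₁, h₂, h₃, h₄, rfl⟩ := hx
  exact ⟨e, fun i => ExteriorAlgebra.map f (r i), fun i => ExteriorAlgebra.map f (s i), h₁, h₂,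
    fun i => ExteriorAlgebra.map_mem_exteriorPower f (h₃ i),
    fun i => ExteriorAlgebra.map_mem_exteriorPower f (h₄ i), by simp⟩

theorem extDecomp_sub_map {u d : ℕ} (hd : 2 ≤ d) (p : M →ₗ[K] M) (b : Fin u → M)
    (hb : ∀ m, ∃ c : Fin u → K, m = ∑ i, c i • b i + p m) {q : ExteriorAlgebra K M}
    (hq : q ∈ ⋀[K]^d M) : ExtDecomp K d (q - ExteriorAlgebra.map p q) u := by
  obtain ⟨d, rfl⟩ : ∃ d', d = d' + 1 := ⟨d - 1, by omega⟩
  obtain ⟨s, hs, h⟩ := ExteriorAlgebra.exists_sub_map_eq_sum p b hb d hq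
  exact ⟨fun _ => 1, fun i => ExteriorAlgebra.ι K (b i), s, fun _ => le_rfl, fun _ => show 1 ≤ d + 1 - 1 by omega,
    fun i => by simp, hs, h⟩

theorem extDecomp_extStrength {n d : ℕ} (hd : 2 ≤ d) {q : ExteriorAlgebra K (Fin n → K)}
    (hq : q ∈ ⋀[K]^d (Fin n → K)) : ExtDecomp K d q (extStrength K d q) := by
  refine Nat.sInf_mem (s := {k | ExtDecomp K d q k}) ⟨n, ?_⟩
  have h := extDecomp_sub_map hd 0 (fun i => Pi.single i (1 : K))
    (fun m => ⟨m, by simpa using pi_eq_sum_univ' m⟩) hq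
  obtain ⟨d, rfl⟩ : ∃ d', d = d' + 1 := ⟨d - 1, by omega⟩
  rwa [ExteriorAlgebra.map_zero_eq_zero hq, sub_zero] at h

end

/-- **Lemma (`lm:AltChopping`).** Let `K` be a field, `d ≥ 2`, `U = K^u` and `V = K^n`.  For
`q ∈ Λ^d(U ⊕ V)` with component decomposition `q = q_0 + ⋯ + q_d`,
`q_i ∈ Λ^{d-i} U ⊗ Λ^i V`, one has `S(q) ≤ dim U + S(q_d)`.  Here the last component
`q_d ∈ Λ^d V` is the image of `q` under `Λ^d` of the projection `U ⊕ V → V`. -/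
theorem extStrength_le_dim_add_extStrength_lastComponent
    (K : Type) [Field K] (d : ℕ) (hd : 2 ≤ d) {u n : ℕ}
    (q : ExteriorAlgebra K ((Fin u → K) × (Fin n → K)))
    (hq : q ∈ ⋀[K]^d ((Fin u → K) × (Fin n → K))) :
    extStrength K d q ≤ u + extStrength K d
      (ExteriorAlgebra.map (LinearMap.snd K (Fin u → K) (Fin n → K)) q) := by
  have hsnd := (extDecomp_extStrength hd (ExteriorAlgebra.map_mem_exteriorPower
    (LinearMap.snd K (Fin u → K) (Fin n → K)) hq)).map
    (LinearMap.inr K (Fin u → K) (Fin n → K))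
  rw [← AlgHom.comp_apply, ExteriorAlgebra.map_comp_map] at hsnd
  have hsub := extDecomp_sub_map hd (LinearMap.inr K (Fin u → K) (Fin n → K) ∘ₗ
    LinearMap.snd K (Fin u → K) (Fin n → K)) (fun i => (Pi.single i (1 : K), 0))
    (fun m => ⟨m.1, by
      ext i
      · simp [Prod.fst_sum, Finset.sum_apply, Pi.single_apply]
      · simp [Prod.snd_sum]⟩) hq
  have h := hsub.add hsnd
  rw [sub_add_cancel] at h
  exact Nat.sInf_le h

end
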